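/- Every definable subset of M^k is a finite union of definable locally closed sets; consequently every definable subset of M^k is a boolean combination of definable open sets. -/

import Mathlib

/-! Common framework: dp-minimal structures with a definable uniform structure,
following "Dp-minimal structures equipped with definable uniformities". -/

namespace DpTame

open FirstOrder Set Cardinal

universe u

variable (L : FirstOrder.Language.{u, u}) (M : Type u) [L.Structure M]

/-- `A ⊆ M^α` is definable with parameters from `C ⊆ M`. -/
def DefSetP (C : Set M) {α : Type} (A : Set (α → M)) : Prop :=
  C.Definable L A

/-- `A ⊆ M^α` is definable (with parameters from `M`). -/
def DefSet {α : Type} (A : Set (α → M)) : Prop :=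
  (Set.univ : Set M).Definable L A

/-- A subset of `M` is definable (with parameters). -/
def DefSet1 (A : Set M) : Prop :=
  DefSet L M {v : Fin 1 → M | v 0 ∈ A}

/-- A definable relation between two tuple sorts, with parameters from `C`. -/
def DefRelP (C : Set M) {k l : ℕ} (G : Set ((Fin k → M) × (Fin l → M))) : Prop :=
  DefSetP L M C {v : (Fin k ⊕ Fin l) → M | (v ∘ Sum.inl, v ∘ Sum.inr) ∈ G}

/-- A definable relation between two tuple sorts, with parameters from `M`. -/
def DefRel {k l : ℕ} (G : Set ((Fin k → M) × (Fin l → M))) : Prop :=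
  DefRelP L M Set.univ G

/-- A definable subset of `M × M`. -/
def DefRel1 (G : Set (M × M)) : Prop :=
  DefSet L M {v : Fin 2 → M | (v 0, v 1) ∈ G}

/-- Model-theoretic algebraic closure of a parameter set `C ⊆ M`:
`a` lies in a finite `C`-definable set. -/
def aclOf (C : Set M) : Set M :=
  {a | ∃ S : Set (Fin 1 → M), C.Definable L S ∧ S.Finite ∧ (fun _ => a) ∈ S}

/-- The acl-dimension of a tuple over `C`: the minimal size of a subtuple over which (together
with `C`) the whole tuple is algebraic. -/
noncomputable def aclDimTuple (C : Set M) {k : ℕ} (a : Fin k → M) : ℕ :=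
  sInf {l | ∃ s : Finset (Fin k), s.card = l ∧ ∀ i, a i ∈ aclOf L M (C ∪ (a '' ↑s))}

open Classical in
/-- The acl-dimension of a set `A ⊆ M^k` defined over `C` (with `⊥` for the empty set). -/
noncomputable def aclDim (C : Set M) {k : ℕ} (A : Set (Fin k → M)) : WithBot ℕ :=
  if A = ∅ then ⊥ else ↑(sSup {l | ∃ a ∈ A, aclDimTuple L M C a = l})

/-- `A ⊆ M^k` has dp-rank greater than `n`: there are (definable-with-parameters) formulas
`φ_i(x,y)` for `i ≤ n` (coded as definable subsets of `M^k × M`) and infinite sets `B i ⊆ M`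
such that every choice from `∏ B i` is coded by an element of `A`. -/
def DpRankGt {k : ℕ} (A : Set (Fin k → M)) (n : ℕ) : Prop :=
  ∃ (Φ : Fin (n + 1) → Set ((Fin k ⊕ Fin 1) → M)) (B : Fin (n + 1) → Set M),
    (∀ i, DefSet L M (Φ i)) ∧ (∀ i, (B i).Infinite) ∧
    ∀ b : Fin (n + 1) → M, (∀ i, b i ∈ B i) →
      ∃ a ∈ A, ∀ i, ∀ y ∈ B i, (Sum.elim a (fun _ => y) ∈ Φ i ↔ y = b i)

open Classical in
/-- The dp-rank of a definable set, with `⊥` for the empty set. -/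
noncomputable def dpRank {k : ℕ} (A : Set (Fin k → M)) : WithBot ℕ :=
  if A = ∅ then ⊥ else ↑(sSup {m : ℕ | ∃ n, m = n + 1 ∧ DpRankGt L M A n})

/-- Dp-minimality (with respect to the home sort `M`): `M` does not have dp-rank greater
than one. -/
def DpMinimal : Prop :=
  ¬ DpRankGt L M (Set.univ : Set (Fin 1 → M)) 1

/-- `M` is NIP: no definable relation has the independence property. -/
def IsNIP : Prop :=
  ∀ (n m : ℕ) (Φ : Set ((Fin n ⊕ Fin m) → M)), DefSet L M Φ →
    ¬ ∃ (a : ℕ → Fin n → M) (b : Finset ℕ → Fin m → M),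
        ∀ (i : ℕ) (s : Finset ℕ), (Sum.elim (a i) (b s) ∈ Φ ↔ i ∈ s)

/-- Every finitely satisfiable collection of formulas in one variable over `C` is realized. -/
def RealizesTypesOver (C : Set M) : Prop :=
  ∀ p : Set ((L[[C]]).Formula (Fin 1)),
    (∀ s : Finset ((L[[C]]).Formula (Fin 1)), ↑s ⊆ p →
      ∃ a : M, ∀ φ ∈ s, φ.Realize (fun _ => a)) →
    ∃ a : M, ∀ φ ∈ p, φ.Realize (fun _ => a)

/-- `M` is `|L|⁺`-saturated. -/
def IsLPlusSaturated : Prop :=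
  ∀ C : Set M, #C ≤ L.card + ℵ₀ → RealizesTypesOver L M C

/-- Two tuples have the same type over `C`. -/
def SameTypeOver (C : Set M) {n : ℕ} (a b : Fin n → M) : Prop :=
  ∀ φ : (L[[C]]).Formula (Fin n), φ.Realize a ↔ φ.Realize b

/-- A sequence indexed by `ℕ` is indiscernible over `C`. -/
def IndiscernibleOver (C : Set M) (I : ℕ → M) : Prop :=
  ∀ (n : ℕ) (f g : Fin n → ℕ), StrictMono f → StrictMono g →
    SameTypeOver L M C (I ∘ f) (I ∘ g)

/-- The sequences `I l` are mutually indiscernible over `C`: each is indiscernible over `C`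
together with all of the other sequences. -/
def MutuallyIndiscernibleOver (C : Set M) {k : ℕ} (I : Fin k → ℕ → M) : Prop :=
  ∀ l : Fin k,
    IndiscernibleOver L M (C ∪ ⋃ m ∈ ({m : Fin k | m ≠ l} : Set (Fin k)), Set.range (I m)) (I l)

/-- A correspondence with domain `E ⊆ M^k`, values in `M^l`, definable over `C`: a definable
graph all of whose fibers over points of `E` are finite and nonempty. -/
def IsCorrP (C : Set M) {k l : ℕ} (E : Set (Fin k → M))
    (G : Set ((Fin k → M) × (Fin l → M))) : Prop :=
  DefRelP L M C G ∧ (∀ p ∈ G, p.1 ∈ E) ∧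
    ∀ x ∈ E, {y | (x, y) ∈ G}.Nonempty ∧ {y | (x, y) ∈ G}.Finite

/-- A correspondence, definable with arbitrary parameters. -/
def IsCorr {k l : ℕ} (E : Set (Fin k → M)) (G : Set ((Fin k → M) × (Fin l → M))) : Prop :=
  IsCorrP L M Set.univ E G

/-- An `m`-correspondence: every fiber has exactly `m` elements. -/
def IsMCorrP (C : Set M) {k l : ℕ} (E : Set (Fin k → M))
    (G : Set ((Fin k → M) × (Fin l → M))) (m : ℕ) : Prop :=
  IsCorrP L M C E G ∧ ∀ x ∈ E, {y | (x, y) ∈ G}.ncard = m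

/-- An `m`-correspondence definable with arbitrary parameters. -/
def IsMCorr {k l : ℕ} (E : Set (Fin k → M)) (G : Set ((Fin k → M) × (Fin l → M)))
    (m : ℕ) : Prop :=
  IsMCorrP L M Set.univ E G m

/-- A definable uniform structure on `M`: a definable basis of entourages
`{φ(M², c̄) : c̄ ∈ dom}` satisfying the axioms for a basis of a (Hausdorff) uniformity. -/
structure DefUniformBasis where
  n : ℕ
  dom : Set (Fin n → M)
  dom_nonempty : dom.Nonempty
  dom_def : DefSet L M dom
  phi : Set ((Fin 2 ⊕ Fin n) → M)
  phi_def : DefSet L M phi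
  symm : ∀ c ∈ dom, ∀ x y : M, Sum.elim ![x, y] c ∈ phi → Sum.elim ![y, x] c ∈ phi
  inter_eq_diag : ∀ x y : M, (∀ c ∈ dom, Sum.elim ![x, y] c ∈ phi) ↔ x = y
  directed : ∀ c ∈ dom, ∀ d ∈ dom, ∃ e ∈ dom, ∀ x y : M,
    Sum.elim ![x, y] e ∈ phi → Sum.elim ![x, y] c ∈ phi ∧ Sum.elim ![x, y] d ∈ phi
  comp : ∀ c ∈ dom, ∃ d ∈ dom, ∀ x y z : M,
    Sum.elim ![x, y] d ∈ phi → Sum.elim ![y, z] d ∈ phi → Sum.elim ![x, z] c ∈ phi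

namespace DefUniformBasis

variable {L M} (U : DefUniformBasis L M)

/-- The entourage with parameter `c`. -/
def ent (c : Fin U.n → M) : Set (M × M) :=
  {p | Sum.elim ![p.1, p.2] c ∈ U.phi}

/-- The ball of radius `c` around `x ∈ M`. -/
def ball (c : Fin U.n → M) (x : M) : Set M :=
  {y | (x, y) ∈ U.ent c}

/-- The ball of radius `c` around `x ∈ M^k` (product uniformity). -/
def ballk {k : ℕ} (c : Fin U.n → M) (x : Fin k → M) : Set (Fin k → M) :=
  {y | ∀ i, (x i, y i) ∈ U.ent c}

/-- Openness in `M` for the topology induced by the uniform structure. -/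
def IsOpen1 (A : Set M) : Prop :=
  ∀ x ∈ A, ∃ c ∈ U.dom, U.ball c x ⊆ A

/-- Interior in `M`. -/
def interior1 (A : Set M) : Set M :=
  {x | ∃ c ∈ U.dom, U.ball c x ⊆ A}

/-- Closure in `M`. -/
def closure1 (A : Set M) : Set M :=
  {x | ∀ c ∈ U.dom, (U.ball c x ∩ A).Nonempty}

/-- Openness in `M^k` for the product topology. -/
def IsOpenk {k : ℕ} (A : Set (Fin k → M)) : Prop :=
  ∀ x ∈ A, ∃ c ∈ U.dom, U.ballk c x ⊆ A

/-- Interior in `M^k`. -/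
def interiork {k : ℕ} (A : Set (Fin k → M)) : Set (Fin k → M) :=
  {x | ∃ c ∈ U.dom, U.ballk c x ⊆ A}

/-- Closure in `M^k`. -/
def closurek {k : ℕ} (A : Set (Fin k → M)) : Set (Fin k → M) :=
  {x | ∀ c ∈ U.dom, (U.ballk c x ∩ A).Nonempty}

/-- The frontier `∂A = cl(A) ∖ A`. -/
def frontierk {k : ℕ} (A : Set (Fin k → M)) : Set (Fin k → M) :=
  U.closurek A \ A

/-- Closedness in `M^k`. -/
def IsClosedk {k : ℕ} (A : Set (Fin k → M)) : Prop :=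
  U.closurek A ⊆ A

/-- `B` is dense in `A`. -/
def DenseIn {k : ℕ} (B A : Set (Fin k → M)) : Prop :=
  A ⊆ U.closurek B

/-- `A ⊆ M^k` is locally closed: every point of `A` has a (ball) neighborhood `W` such that
`A ∩ W` is closed in `W`. -/
def IsLocallyClosedk {k : ℕ} (A : Set (Fin k → M)) : Prop :=
  ∀ x ∈ A, ∃ c ∈ U.dom, U.ballk c x ∩ U.closurek (A ∩ U.ballk c x) ⊆ A

open Classical in
/-- The naive topological dimension of `A ⊆ M^k`: the largest `l` such that some coordinate
projection of `A` to `M^l` has nonempty interior (`⊥` for the empty set). -/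
noncomputable def topDim {k : ℕ} (A : Set (Fin k → M)) : WithBot ℕ :=
  if A = ∅ then ⊥ else
    ↑(sSup {l : ℕ | ∃ σ : Fin l → Fin k, Function.Injective σ ∧
        (U.interiork ((fun v => v ∘ σ) '' A)).Nonempty})

/-- Continuity of a correspondence with domain `E` and graph `G` at a point `x ∈ E`. -/
def CorrContAt {k l : ℕ} (E : Set (Fin k → M)) (G : Set ((Fin k → M) × (Fin l → M)))
    (x : Fin k → M) : Prop :=
  ∀ c ∈ U.dom, ∃ d ∈ U.dom, ∀ x' ∈ E, x' ∈ U.ballk d x →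
    (∀ y, (x, y) ∈ G → ∃ y', (x', y') ∈ G ∧ ∀ j, (y j, y' j) ∈ U.ent c) ∧
    (∀ y', (x', y') ∈ G → ∃ y, (x, y) ∈ G ∧ ∀ j, (y j, y' j) ∈ U.ent c)

/-- Continuity of a correspondence at every point of its domain. -/
def CorrContOn {k l : ℕ} (E : Set (Fin k → M)) (G : Set ((Fin k → M) × (Fin l → M))) : Prop :=
  ∀ x ∈ E, U.CorrContAt E G x

/-- Continuity of a function `M^k → M^l` on a set `V` (relative topology). -/
def ContOn {k l : ℕ} (f : (Fin k → M) → (Fin l → M)) (V : Set (Fin k → M)) : Prop :=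
  ∀ x ∈ V, ∀ c ∈ U.dom, ∃ d ∈ U.dom, ∀ y ∈ V, y ∈ U.ballk d x → f y ∈ U.ballk c (f x)

/-- `f` restricted to `V` is a homeomorphism onto its image. -/
def HomeoOnto {k l : ℕ} (f : (Fin k → M) → (Fin l → M)) (V : Set (Fin k → M)) : Prop :=
  Set.InjOn f V ∧ U.ContOn f V ∧
    ∀ x ∈ V, ∀ c ∈ U.dom, ∃ d ∈ U.dom, ∀ y ∈ V, f y ∈ U.ballk d (f x) → y ∈ U.ballk c x

/-- Continuity of a function `M → M` on a set `V`. -/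
def Cont1On (f : M → M) (V : Set M) : Prop :=
  ∀ x ∈ V, ∀ c ∈ U.dom, ∃ d ∈ U.dom, ∀ y ∈ V, y ∈ U.ball d x → f y ∈ U.ball c (f x)

/-- `f : M → M` restricted to `V` is a homeomorphism onto its image. -/
def Homeo1Onto (f : M → M) (V : Set M) : Prop :=
  Set.InjOn f V ∧ U.Cont1On f V ∧
    ∀ x ∈ V, ∀ c ∈ U.dom, ∃ d ∈ U.dom, ∀ y ∈ V, f y ∈ U.ball d (f x) → y ∈ U.ball c x

end DefUniformBasis

/-- The standing assumptions of the paper: `M` is an infinite `|L|⁺`-saturated NIP dp-minimal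
structure carrying a definable uniform structure whose topology has no isolated points and in
which every infinite definable subset of `M` has nonempty interior (Inf). -/
structure Setting extends DefUniformBasis L M where
  nonempty : Nonempty M
  saturated : IsLPlusSaturated L M
  nip : IsNIP L M
  dpMin : DpMinimal L M
  noIsolated : ∀ x : M, ∀ c ∈ toDefUniformBasis.dom, ∃ y, y ≠ x ∧
    y ∈ toDefUniformBasis.ball c x
  infInterior : ∀ A : Set M, DefSet1 L M A → A.Infinite →
    (toDefUniformBasis.interior1 A).Nonempty

end DpTame

namespace DpTame

open FirstOrder Set Cardinal

universe u

variable {L : FirstOrder.Language.{u, u}} {M : Type u} [L.Structure M]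

section Definability

variable {C : Set M} {α ι κ : Type}

theorem definable_mem [Finite κ] {X : Set (κ → M)} (hX : C.Definable L X)
    {g : (α → M) → κ → M} (hg : C.DefinableMap L g) : C.Definable L {v | g v ∈ X} :=
  Definable.preimage_map hg hX

theorem definable_and {P Q : (α → M) → Prop} (hP : C.Definable L {v | P v})
    (hQ : C.Definable L {v | Q v}) : C.Definable L {v | P v ∧ Q v} :=
  hP.inter hQ

theorem definable_not {P : (α → M) → Prop} (hP : C.Definable L {v | P v}) :
    C.Definable L {v | ¬ P v} :=
  hP.compl

theorem definable_imp {P Q : (α → M) → Prop} (hP : C.Definable L {v | P v})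
    (hQ : C.Definable L {v | Q v}) : C.Definable L {v | P v → Q v} := by
  simpa only [imp_iff_not_or] using! (definable_not hP).union hQ

theorem definable_const (p : Prop) : C.Definable L {_v : α → M | p} := by
  by_cases h : p
  · simpa only [h] using! (definable_univ : C.Definable L (Set.univ : Set (α → M)))
  · simpa only [h] using! (definable_empty : C.Definable L (∅ : Set (α → M)))

theorem definable_exists [Finite κ] {P : (α → M) → (κ → M) → Prop}
    (h : C.Definable L {u : α ⊕ κ → M | P (u ∘ Sum.inl) (u ∘ Sum.inr)}) :
    C.Definable L {v | ∃ w, P v w} :=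
  Definable.exists_of_finite h

theorem definable_forall [Finite κ] {P : (α → M) → (κ → M) → Prop}
    (h : C.Definable L {u : α ⊕ κ → M | P (u ∘ Sum.inl) (u ∘ Sum.inr)}) :
    C.Definable L {v | ∀ w, P v w} :=
  Definable.forall_of_finite h

theorem definable_exists₁ {P : (α → M) → M → Prop}
    (h : C.Definable L {u : α ⊕ Fin 1 → M | P (u ∘ Sum.inl) (u (Sum.inr 0))}) :
    C.Definable L {v | ∃ y, P v y} := by
  have := definable_exists (P := fun v w => P v (w 0)) h
  convert this using 3
  exact ⟨fun ⟨y, hy⟩ => ⟨fun _ => y, hy⟩, fun ⟨w, hw⟩ => ⟨w 0, hw⟩⟩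

theorem definable_forall₁ {P : (α → M) → M → Prop}
    (h : C.Definable L {u : α ⊕ Fin 1 → M | P (u ∘ Sum.inl) (u (Sum.inr 0))}) :
    C.Definable L {v | ∀ y, P v y} := by
  have := definable_forall (P := fun v w => P v (w 0)) h
  convert this using 3
  exact ⟨fun h w => h (w 0), fun h y => h fun _ => y⟩

theorem definable_forall_finite [Finite ι] {P : ι → (α → M) → Prop}
    (h : ∀ i, C.Definable L {v | P i v}) : C.Definable L {v | ∀ i, P i v} := by
  simpa only [Set.ofPred_forall] using definable_iInter_of_finite h

theorem definable_eq {g h : (α → M) → M} (hg : C.DefinableFun L g) (hh : C.DefinableFun L h) :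
    C.Definable L {v | g v = h v} :=
  DefinableFun.ofPred_eq hg hh

theorem definableMap_sumElim {g : (α → M) → ι → M} {h : (α → M) → κ → M}
    (hg : C.DefinableMap L g) (hh : C.DefinableMap L h) :
    C.DefinableMap L (fun v => Sum.elim (g v) (h v)) :=
  Sum.rec hg hh

theorem definableMap_cons {k : ℕ} {g : (α → M) → M} {h : (α → M) → Fin k → M}
    (hg : C.DefinableFun L g) (hh : C.DefinableMap L h) :
    C.DefinableMap L (fun v => (Fin.cons (g v) (h v) : Fin (k + 1) → M)) :=
  Fin.cases hg hh

theorem definableMap_update {k : ℕ} {g : (α → M) → M} {h : (α → M) → Fin k → M} (i : Fin k)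
    (hg : C.DefinableFun L g) (hh : C.DefinableMap L h) :
    C.DefinableMap L (fun v => Function.update (h v) i (g v)) := by
  intro j
  by_cases hj : j = i
  · subst hj; simpa using hg
  · simpa [hj] using hh j

theorem definableMap_comp (f : κ → α) : C.DefinableMap L (fun v : α → M => v ∘ f) :=
  fun _ => (DefinableFun.proj L)

/-- A definable family of subsets of `M^κ`, parametrized by `M^ι`. -/
def DefFam (C : Set M) (L : FirstOrder.Language.{u, u}) [L.Structure M]
    (X : (ι → M) → Set (κ → M)) : Prop :=
  C.Definable L {v : ι ⊕ κ → M | v ∘ Sum.inr ∈ X (v ∘ Sum.inl)}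

/-- A definable family of subsets of `M`, parametrized by `M^ι`. -/
def DefFam₁ (C : Set M) (L : FirstOrder.Language.{u, u}) [L.Structure M]
    (X : (ι → M) → Set M) : Prop :=
  C.Definable L {v : ι ⊕ Fin 1 → M | v (Sum.inr 0) ∈ X (v ∘ Sum.inl)}

theorem DefFam.mem [Finite ι] [Finite κ] {X : (ι → M) → Set (κ → M)} (hX : DefFam C L X)
    {g : (α → M) → ι → M} {h : (α → M) → κ → M} (hg : C.DefinableMap L g)
    (hh : C.DefinableMap L h) : C.Definable L {v | h v ∈ X (g v)} :=
  definable_mem hX (definableMap_sumElim hg hh)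

theorem DefFam₁.mem [Finite ι] {X : (ι → M) → Set M} (hX : DefFam₁ C L X)
    {g : (α → M) → ι → M} {h : (α → M) → M} (hg : C.DefinableMap L g)
    (hh : C.DefinableFun L h) : C.Definable L {v | h v ∈ X (g v)} :=
  definable_mem hX (definableMap_sumElim hg (fun _ : Fin 1 => hh))

theorem definableFun_univ_const (m : M) : (Set.univ : Set M).DefinableFun L fun _ : α → M => m :=
  L.definableFun_const α (mem_univ m)

theorem definableMap_univ_const (m : κ → M) :
    (Set.univ : Set M).DefinableMap L fun _ : α → M => m :=
  fun i => definableFun_univ_const (m i)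

end Definability

section Saturation

theorem exists_forall_mem_of_antitone₁ (hsat : IsLPlusSaturated L M) {C : Set M}
    (hC : C.Finite) {E : ℕ → Set M}
    (hE : ∀ n, C.Definable L {v : Fin 1 → M | v 0 ∈ E n}) (hanti : Antitone E)
    (hne : ∀ n, (E n).Nonempty) : ∃ x, ∀ n, x ∈ E n := by
  have hcard : #C ≤ L.card + ℵ₀ :=
    (lt_aleph0_iff_set_finite.2 hC).le.trans (self_le_add_left _ _)
  choose φ hφ using hE
  have key : ∀ n x, (φ n).Realize (fun _ => x) ↔ x ∈ E n := fun n x => by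
    have := congrArg (fun s => (fun _ => x : Fin 1 → M) ∈ s) (hφ n)
    exact (Iff.of_eq this).symm
  obtain ⟨a, ha⟩ := hsat C hcard (Set.range φ) (by
    intro s hs
    have : ∃ N, ∀ ψ ∈ s, ∃ n ≤ N, φ n = ψ := by
      choose! f hf using fun ψ (h : ψ ∈ s) => hs h
      exact ⟨s.sup f, fun ψ h => ⟨f ψ, Finset.le_sup h, hf ψ h⟩⟩
    obtain ⟨N, hN⟩ := this
    obtain ⟨a, ha⟩ := hne N
    refine ⟨a, fun ψ h => ?_⟩
    obtain ⟨n, hn, rfl⟩ := hN ψ h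
    exact (key n a).2 (hanti hn ha))
  exact ⟨a, fun n => (key n a).1 (ha _ ⟨n, rfl⟩)⟩

theorem exists_forall_mem_of_antitone (hsat : IsLPlusSaturated L M) {q : ℕ} {C : Set M}
    (hC : C.Finite)
    {E : ℕ → Set (Fin q → M)} (hE : ∀ n, C.Definable L (E n)) (hanti : Antitone E)
    (hne : ∀ n, (E n).Nonempty) : ∃ x, ∀ n, x ∈ E n := by
  induction q generalizing C with
  | zero =>
    obtain ⟨x, _⟩ := hne 0
    exact ⟨x, fun n => by obtain ⟨y, hy⟩ := hne n; rwa [Subsingleton.elim x y]⟩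
  | succ q ih =>
    obtain ⟨x, hx⟩ := exists_forall_mem_of_antitone₁ hsat hC
      (E := fun n => {x | ∃ y : Fin q → M, (Fin.cons x y : Fin (q + 1) → M) ∈ E n})
      (fun n => definable_exists
        (P := fun v (y : Fin q → M) => (Fin.cons (v 0) y : Fin (q + 1) → M) ∈ E n)
        (definable_mem (hE n) (definableMap_cons (DefinableFun.proj L) (definableMap_comp _))))
      (fun m n h x ⟨y, hy⟩ => ⟨y, hanti h hy⟩)
      (fun n => by
        obtain ⟨z, hz⟩ := hne n
        exact ⟨z 0, Fin.tail z, by rwa [Fin.cons_self_tail]⟩)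
    obtain ⟨y, hy⟩ := ih (C := insert x C) (hC.insert x)
      (E := fun n => {y | (Fin.cons x y : Fin (q + 1) → M) ∈ E n})
      (fun n => definable_mem ((hE n).mono (Set.subset_insert x C))
        (definableMap_cons (L.definableFun_const _ (Set.mem_insert x C))
          (definableMap_comp id)))
      (fun m n h y hy => hanti h hy) hx
    exact ⟨_, hy⟩

/-- In a definable family of subsets of `M` without a uniform finite bound some member is
infinite. -/
theorem exists_infinite_of_unbounded (hsat : IsLPlusSaturated L M) {ι : Type} [Finite ι]
    {D : (ι → M) → Set M}
    (hD : DefFam₁ Set.univ L D)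
    (h : ∀ n, ∃ p, ∃ f : Fin n → M, Function.Injective f ∧ ∀ i, f i ∈ D p) :
    ∃ p, (D p).Infinite := by
  obtain ⟨C, -, hC⟩ := definable_iff_finitely_definable.1 hD
  obtain ⟨q, ⟨e⟩⟩ := Finite.exists_equiv_fin ι
  obtain ⟨p, hp⟩ := exists_forall_mem_of_antitone hsat C.finite_toSet (q := q)
    (E := fun n => {p | ∃ f : Fin n → M, (∀ i j, f i = f j → i = j) ∧ ∀ i, f i ∈ D (p ∘ e)})
    (fun n => definable_exists <| definable_and
      (definable_forall_finite fun i => definable_forall_finite fun j =>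
        definable_imp (definable_eq (DefinableFun.proj L) (DefinableFun.proj L)) (definable_const _))
      (definable_forall_finite fun i =>
        DefFam₁.mem hC (g := fun u => (u ∘ Sum.inl) ∘ e) (fun _ => (DefinableFun.proj L))
          (DefinableFun.proj L)))
    (fun m n hmn p ⟨f, hf, hfD⟩ => ⟨f ∘ Fin.castLE hmn,
      fun i j hij => Fin.castLE_injective hmn (hf _ _ hij), fun i => hfD _⟩)
    (fun n => by
      obtain ⟨p, f, hf, hfD⟩ := h n
      exact ⟨p ∘ e.symm, f, fun i j => @hf i j, fun i => by
        simpa [Function.comp_assoc] using hfD i⟩)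
  refine ⟨p ∘ e, fun hfin => ?_⟩
  obtain ⟨f, hf, hfD⟩ := hp (hfin.toFinset.card + 1)
  have := Finset.card_le_card_of_injOn (s := Finset.univ) (t := hfin.toFinset) f
    (fun i _ => by simpa using hfD i) (fun i _ j _ => hf i j)
  simp at this

end Saturation

section Grid

/-- `X ⊆ M^k` contains a product of `k` sets of size at least `N`. -/
def HasGrid {k : ℕ} (N : ℕ) (X : Set (Fin k → M)) : Prop :=
  ∃ B : Fin k → Finset M, (∀ i, N ≤ (B i).card) ∧ ∀ x, (∀ i, x i ∈ B i) → x ∈ X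

theorem HasGrid.mono {k N N' : ℕ} {X Y : Set (Fin k → M)} (hX : HasGrid N X) (hN : N' ≤ N)
    (hXY : X ⊆ Y) : HasGrid N' Y := by
  obtain ⟨B, hB, hBX⟩ := hX
  exact ⟨B, fun i => hN.trans (hB i), fun x hx => hXY (hBX x hx)⟩

/-- A product Ramsey theorem: large grids coloured with finitely many colours contain large
monochromatic subgrids. -/
theorem exists_monochromatic_grid (k N : ℕ) (κ : Type) [Finite κ] [Nonempty κ] :
    ∃ N', ∀ B : Fin k → Finset M, (∀ i, N' ≤ (B i).card) → ∀ col : (Fin k → M) → κ,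
      ∃ B' : Fin k → Finset M, (∀ i, B' i ⊆ B i) ∧ (∀ i, N ≤ (B' i).card) ∧
        ∃ a, ∀ x, (∀ i, x i ∈ B' i) → col x = a := by
  classical
  induction k generalizing κ with
  | zero =>
    exact ⟨0, fun B _ col => ⟨B, fun i => i.elim0, fun i => i.elim0, col Fin.elim0,
      fun x _ => congrArg col (Subsingleton.elim _ _)⟩⟩
  | succ k ih =>
    have := Fintype.ofFinite κ
    set m := Fintype.card κ * N with hm
    obtain ⟨N', hN'⟩ := ih (Fin m → κ)
    refine ⟨max m N', fun B hB col => ?_⟩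
    obtain ⟨B₀, hB₀, hcard⟩ := Finset.exists_subset_card_eq ((le_max_left m N').trans (hB 0))
    let e : Fin m ≃ B₀ := (B₀.equivFinOfCardEq hcard).symm
    obtain ⟨B', hB', hB'N, a, ha⟩ := hN' (fun i => B i.succ)
      (fun i => (le_max_right m N').trans (hB _))
      (fun z i => col (Fin.cons (e i : M) z))
    obtain ⟨y, -, hy⟩ := Finset.exists_le_card_fiber_of_mul_le_card_of_maps_to
      (s := (Finset.univ : Finset (Fin m))) (t := (Finset.univ : Finset κ)) (f := a) (n := N)
      (fun _ _ => Finset.mem_univ _) Finset.univ_nonempty (by simp [hm])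
    refine ⟨Fin.cons (({i | a i = y} : Finset (Fin m)).image fun i => (e i : M)) B',
      Fin.forall_fin_succ.2 ⟨?_, ?_⟩, Fin.forall_fin_succ.2 ⟨?_, ?_⟩, y, fun x hx => ?_⟩
    · intro z hz
      simp only [Fin.cons_zero, Finset.mem_image] at hz
      obtain ⟨i, -, rfl⟩ := hz
      exact hB₀ (e i).2
    · simpa using hB'
    · have hinj : Function.Injective fun i => (e i : M) :=
        Subtype.val_injective.comp e.injective
      rwa [Fin.cons_zero, Finset.card_image_of_injective _ hinj]
    · simpa using hB'N
    · have h0 := hx 0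
      simp only [Fin.cons_zero, Finset.mem_image, Finset.mem_filter, Finset.mem_univ,
        true_and] at h0
      obtain ⟨i, hi, hix⟩ := h0
      have := congrFun (ha (Fin.tail x) fun j => by
        have := hx j.succ
        rwa [Fin.cons_succ] at this) i
      simpa [hix, hi] using this

theorem exists_hasGrid_of_iUnion {k : ℕ} {κ : Type} [Finite κ] {X : κ → Set (Fin k → M)}
    (h : ∀ N, HasGrid N (⋃ j, X j)) : ∃ j, ∀ N, HasGrid N (X j) := by
  classical
  obtain ⟨B, -, -⟩ := h 0
  by_contra! hcon
  choose n hn using hcon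
  rcases isEmpty_or_nonempty κ with hκ | hκ
  · obtain ⟨B, hB, hBX⟩ := h 1
    have hne : ∀ i, (B i).Nonempty := fun i => Finset.card_pos.1 (hB i)
    choose x hx using hne
    simpa using hBX x hx
  have := Fintype.ofFinite κ
  obtain ⟨N', hN'⟩ := exists_monochromatic_grid (M := M) k (Finset.univ.sup n) κ
  obtain ⟨B, hB, hBX⟩ := h (max N' 1)
  let col : (Fin k → M) → κ := fun x => if hx : ∃ j, x ∈ X j then hx.choose else
    Classical.arbitrary κ
  have hcol : ∀ x, (∀ i, x i ∈ B i) → x ∈ X (col x) := fun x hx => by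
    have hx' : ∃ j, x ∈ X j := by simpa using hBX x hx
    simp only [col, dif_pos hx']
    exact hx'.choose_spec
  obtain ⟨B', hB', hB'N, a, ha⟩ := hN' B (fun i => (le_max_left _ _).trans (hB i)) col
  refine hn a ⟨B', fun i => (Finset.le_sup (Finset.mem_univ a)).trans (hB'N i), fun x hx => ?_⟩
  rw [← ha x hx]
  exact hcol x fun i => hB' i (hx i)

end Grid

namespace DefUniformBasis

variable (U : DefUniformBasis L M)

/-- `X ⊆ M^k` has nonempty interior. -/
def HasInt {k : ℕ} (X : Set (Fin k → M)) : Prop :=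
  (U.interiork X).Nonempty

variable {U}

theorem HasInt.mono {k : ℕ} {X Y : Set (Fin k → M)} (h : U.HasInt X) (hXY : X ⊆ Y) :
    U.HasInt Y := by
  obtain ⟨x, c, hc, hx⟩ := h
  exact ⟨x, c, hc, hx.trans hXY⟩

theorem ent_refl {c : Fin U.n → M} (hc : c ∈ U.dom) (x : M) : (x, x) ∈ U.ent c :=
  (U.inter_eq_diag x x).2 rfl c hc

theorem ent_symm {c : Fin U.n → M} (hc : c ∈ U.dom) {x y : M} (h : (x, y) ∈ U.ent c) :
    (y, x) ∈ U.ent c :=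
  U.symm c hc x y h

theorem exists_ent_comp {c : Fin U.n → M} (hc : c ∈ U.dom) : ∃ d ∈ U.dom, ∀ x y z : M,
    (x, y) ∈ U.ent d → (y, z) ∈ U.ent d → (x, z) ∈ U.ent c :=
  U.comp c hc

theorem ent_subset_of_comp {c d : Fin U.n → M} (hd : d ∈ U.dom) (h : ∀ x y z : M,
    (x, y) ∈ U.ent d → (y, z) ∈ U.ent d → (x, z) ∈ U.ent c) : U.ent d ⊆ U.ent c :=
  fun ⟨x, y⟩ hxy => h x y y hxy (ent_refl hd y)

theorem exists_ent_subset₂ {c d : Fin U.n → M} (hc : c ∈ U.dom) (hd : d ∈ U.dom) :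
    ∃ e ∈ U.dom, U.ent e ⊆ U.ent c ∧ U.ent e ⊆ U.ent d := by
  obtain ⟨e, he, h⟩ := U.directed c hc d hd
  exact ⟨e, he, fun p hp => (h p.1 p.2 hp).1, fun p hp => (h p.1 p.2 hp).2⟩

theorem exists_ent_subset_finset {β : Type*} (s : Finset β) {c : β → Fin U.n → M}
    (hc : ∀ i ∈ s, c i ∈ U.dom) : ∃ e ∈ U.dom, ∀ i ∈ s, U.ent e ⊆ U.ent (c i) := by
  classical
  induction s using Finset.induction_on with
  | empty =>
    obtain ⟨e, he⟩ := U.dom_nonempty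
    exact ⟨e, he, by simp⟩
  | insert a s _ ih =>
    obtain ⟨e, he, h⟩ := ih fun i hi => hc i (Finset.mem_insert_of_mem hi)
    obtain ⟨d, hd, hde, hda⟩ := exists_ent_subset₂ he (hc a (Finset.mem_insert_self a s))
    refine ⟨d, hd, fun i hi => ?_⟩
    rcases Finset.mem_insert.1 hi with rfl | hi
    · exact hda
    · exact hde.trans (h i hi)

theorem mem_ballk_self {k : ℕ} {c : Fin U.n → M} (hc : c ∈ U.dom) (x : Fin k → M) :
    x ∈ U.ballk c x :=
  fun i => ent_refl hc (x i)

theorem ballk_mono {k : ℕ} {c d : Fin U.n → M} (h : U.ent d ⊆ U.ent c) (x : Fin k → M) :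
    U.ballk d x ⊆ U.ballk c x :=
  fun _ hy i => h (hy i)

theorem exists_ballk_subset_ballk {k : ℕ} {c : Fin U.n → M} (hc : c ∈ U.dom) :
    ∃ d ∈ U.dom, ∀ x : Fin k → M, ∀ y ∈ U.ballk d x, U.ballk d y ⊆ U.ballk c x := by
  obtain ⟨d, hd, h⟩ := exists_ent_comp hc
  exact ⟨d, hd, fun x y hy z hz i => h _ _ _ (hy i) (hz i)⟩

theorem isOpenk_interiork {k : ℕ} (X : Set (Fin k → M)) : U.IsOpenk (U.interiork X) := by
  rintro x ⟨c, hc, hx⟩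
  obtain ⟨d, hd, h⟩ := exists_ballk_subset_ballk (k := k) hc
  exact ⟨d, hd, fun y hy => ⟨d, hd, (h x y hy).trans hx⟩⟩

theorem interiork_subset {k : ℕ} (X : Set (Fin k → M)) : U.interiork X ⊆ X := by
  rintro x ⟨c, hc, hx⟩
  exact hx (mem_ballk_self hc x)

theorem compl_closurek {k : ℕ} (X : Set (Fin k → M)) : (U.closurek X)ᶜ = U.interiork Xᶜ := by
  ext x
  simp only [closurek, interiork, mem_compl_iff, Set.mem_ofPred_eq, not_forall,
    Set.not_nonempty_iff_eq_empty, exists_prop]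
  refine exists_congr fun c => and_congr_right fun _ => ?_
  rw [← Set.disjoint_iff_inter_eq_empty, Set.subset_compl_iff_disjoint_right]

theorem isOpenk_preimage_comp {k d : ℕ} (σ : Fin d → Fin k) {V : Set (Fin d → M)}
    (hV : U.IsOpenk V) : U.IsOpenk {x : Fin k → M | x ∘ σ ∈ V} := by
  intro x hx
  obtain ⟨c, hc, h⟩ := hV _ hx
  exact ⟨c, hc, fun y hy => h fun i => hy (σ i)⟩

theorem isLocallyClosedk_sdiff {k : ℕ} {V W : Set (Fin k → M)} (hV : U.IsOpenk V)
    (hW : U.IsOpenk W) : U.IsLocallyClosedk (V \ W) := by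
  rintro x ⟨hxV, -⟩
  obtain ⟨c, hc, h⟩ := hV x hxV
  refine ⟨c, hc, fun y ⟨hyc, hy⟩ => ⟨h hyc, fun hyW => ?_⟩⟩
  obtain ⟨d, hd, h'⟩ := hW y hyW
  obtain ⟨z, hz, hz', -⟩ := hy d hd
  exact hz'.2 (h' hz)

section Definability

variable {α : Type}

theorem definable_ent {s t : (α → M) → M} {c : (α → M) → Fin U.n → M}
    (hs : (Set.univ : Set M).DefinableFun L s) (ht : (Set.univ : Set M).DefinableFun L t)
    (hc : (Set.univ : Set M).DefinableMap L c) :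
    (Set.univ : Set M).Definable L {v | (s v, t v) ∈ U.ent (c v)} :=
  definable_mem (g := fun v => Sum.elim ![s v, t v] (c v)) U.phi_def
    (definableMap_sumElim (Fin.cases hs (Fin.cases ht fun i => i.elim0)) hc)

theorem definable_ball {s t : (α → M) → M} {c : (α → M) → Fin U.n → M}
    (ht : (Set.univ : Set M).DefinableFun L t) (hs : (Set.univ : Set M).DefinableFun L s)
    (hc : (Set.univ : Set M).DefinableMap L c) :
    (Set.univ : Set M).Definable L {v | t v ∈ U.ball (c v) (s v)} :=
  definable_ent hs ht hc

theorem definable_ballk {k : ℕ} {x y : (α → M) → Fin k → M} {c : (α → M) → Fin U.n → M}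
    (hy : (Set.univ : Set M).DefinableMap L y) (hx : (Set.univ : Set M).DefinableMap L x)
    (hc : (Set.univ : Set M).DefinableMap L c) :
    (Set.univ : Set M).Definable L {v | y v ∈ U.ballk (c v) (x v)} :=
  definable_forall_finite fun i => definable_ent (hx i) (hy i) hc

theorem definable_dom {c : (α → M) → Fin U.n → M}
    (hc : (Set.univ : Set M).DefinableMap L c) :
    (Set.univ : Set M).Definable L {v | c v ∈ U.dom} :=
  definable_mem U.dom_def hc

theorem definable_interiork {k : ℕ} {X : Set (Fin k → M)} (hX : DefSet L M X) :
    DefSet L M (U.interiork X) :=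
  definable_exists <| definable_and (definable_dom (definableMap_comp _)) <|
    definable_forall (P := fun u y => y ∈ U.ballk (u ∘ Sum.inr) (u ∘ Sum.inl) → y ∈ X) <|
      definable_imp
        (definable_ballk (definableMap_comp _) (definableMap_comp _) (definableMap_comp _))
        (definable_mem hX (definableMap_comp _))

theorem definable_closurek {k : ℕ} {X : Set (Fin k → M)} (hX : DefSet L M X) :
    DefSet L M (U.closurek X) := by
  have := (definable_interiork (U := U) (Set.Definable.compl hX)).compl
  rwa [← compl_closurek, compl_compl] at this

end Definability

end DefUniformBasis

namespace Setting

variable {S : Setting L M}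

open DefUniformBasis

theorem ball_infinite {c : Fin S.n → M} (hc : c ∈ S.dom) (x : M) :
    (S.toDefUniformBasis.ball c x).Infinite := by
  classical
  intro hfin
  have key : ∀ y, y ≠ x → ∃ d ∈ S.dom, (x, y) ∉ S.toDefUniformBasis.ent d := fun y hy => by
    by_contra! h
    exact hy ((S.inter_eq_diag x y).1 h).symm
  choose! d hd hxy using key
  obtain ⟨e, he, h⟩ := exists_ent_subset_finset (U := S.toDefUniformBasis)
    (hfin.toFinset.filter (· ≠ x)) (c := d) fun y hy => hd y (Finset.mem_filter.1 hy).2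
  obtain ⟨e', he', hec, hee⟩ := exists_ent_subset₂ hc he
  obtain ⟨y, hyx, hy⟩ := S.noIsolated x e' he'
  exact hxy y hyx (h y (by simpa using! ⟨hec hy, hyx⟩) (hee hy))

theorem exists_ball_subset_of_infinite {D : Set M} (hD : DefSet1 L M D) (hinf : D.Infinite) :
    ∃ x, ∃ c ∈ S.dom, S.toDefUniformBasis.ball c x ⊆ D :=
  S.infInterior D hD hinf

theorem hasGrid_of_hasInt {k : ℕ} {X : Set (Fin k → M)} (hX : S.toDefUniformBasis.HasInt X)
    (N : ℕ) : HasGrid N X := by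
  obtain ⟨x, c, hc, hx⟩ := hX
  choose B hB hBN using fun i => (ball_infinite hc (x i)).exists_subset_card_eq N
  exact ⟨B, fun i => (hBN i).ge, fun y hy => hx fun i => hB i (hy i)⟩

/-- If the members of a definable family contain arbitrarily large grids, then some member has
nonempty interior. -/
theorem exists_hasInt_of_hasGrid {k : ℕ} {ι : Type} [Finite ι] {X : (ι → M) → Set (Fin k → M)}
    (hX : DefFam Set.univ L X) (h : ∀ N, ∃ p, HasGrid N (X p)) :
    ∃ p, S.toDefUniformBasis.HasInt (X p) := by
  induction k generalizing ι with
  | zero =>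
    obtain ⟨p, B, -, hB⟩ := h 0
    obtain ⟨c, hc⟩ := S.dom_nonempty
    exact ⟨p, Fin.elim0, c, hc, fun y _ => hB y fun i => i.elim0⟩
  | succ k ih =>
    have hY : ∀ n : ℕ, ∃ w : ι ⊕ Fin n → M, S.toDefUniformBasis.HasInt
        {y : Fin k → M | (∀ i j, w (Sum.inr i) = w (Sum.inr j) → i = j) ∧
          ∀ i, (Fin.cons (w (Sum.inr i)) y : Fin (k + 1) → M) ∈ X (w ∘ Sum.inl)} := fun n => by
      refine ih (definable_and
        (definable_forall_finite fun i => definable_forall_finite fun j =>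
          definable_imp (definable_eq (DefinableFun.proj L) (DefinableFun.proj L))
            (definable_const _))
        (definable_forall_finite fun i => hX.mem (g := fun v => (v ∘ Sum.inl) ∘ Sum.inl)
          (fun _ => DefinableFun.proj L)
          (definableMap_cons (DefinableFun.proj L) (definableMap_comp _)))) fun N => ?_
      obtain ⟨p, B, hB, hBX⟩ := h (max n N)
      obtain ⟨B₀, hB₀, hcard⟩ :=
        Finset.exists_subset_card_eq ((le_max_left n N).trans (hB 0))
      let e : Fin n ≃ B₀ := (B₀.equivFinOfCardEq hcard).symm
      refine ⟨Sum.elim p fun i => e i, Fin.tail B, fun i => (le_max_right _ _).trans (hB _),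
        fun y hy => ⟨fun i j hij => e.injective (Subtype.ext hij), fun i => hBX _ ?_⟩⟩
      exact Fin.cases (hB₀ (e i).2) hy
    obtain ⟨w, hw⟩ := exists_infinite_of_unbounded S.saturated
      (D := fun w : ι ⊕ (Fin k ⊕ Fin S.n) → M => {x | (w ∘ Sum.inr) ∘ Sum.inr ∈ S.dom ∧
        ∀ y : Fin k → M, y ∈ S.toDefUniformBasis.ballk ((w ∘ Sum.inr) ∘ Sum.inr)
          ((w ∘ Sum.inr) ∘ Sum.inl) → (Fin.cons x y : Fin (k + 1) → M) ∈ X (w ∘ Sum.inl)})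
      (definable_and (definable_dom fun _ => DefinableFun.proj L) <|
        definable_forall
          (P := fun v y => y ∈ S.toDefUniformBasis.ballk (((v ∘ Sum.inl) ∘ Sum.inr) ∘ Sum.inr)
            (((v ∘ Sum.inl) ∘ Sum.inr) ∘ Sum.inl) →
              (Fin.cons (v (Sum.inr 0)) y : Fin (k + 1) → M) ∈ X ((v ∘ Sum.inl) ∘ Sum.inl)) <|
          definable_imp
            (definable_ballk (definableMap_comp _) (fun _ => DefinableFun.proj L)
              (fun _ => DefinableFun.proj L))
            (hX.mem (g := fun v => ((v ∘ Sum.inl) ∘ Sum.inl) ∘ Sum.inl)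
              (fun _ => DefinableFun.proj L)
              (definableMap_cons (DefinableFun.proj L) (definableMap_comp _))))
      (fun n => by
        obtain ⟨w, y, c, hc, hyc⟩ := hY n
        refine ⟨Sum.elim (w ∘ Sum.inl) (Sum.elim y c), fun i => w (Sum.inr i),
          (hyc (mem_ballk_self hc y)).1, fun i => ⟨hc, fun z hz => (hyc hz).2 i⟩⟩)
    obtain ⟨x, c, hc, hx⟩ := exists_ball_subset_of_infinite (S := S) (by
      have := definable_and (α := Fin 1) (L := L) (C := Set.univ)
        (definable_dom (U := S.toDefUniformBasis)
          (definableMap_univ_const ((w ∘ Sum.inr) ∘ Sum.inr)))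
        (definable_forall
          (P := fun v y => y ∈ S.toDefUniformBasis.ballk ((w ∘ Sum.inr) ∘ Sum.inr)
            ((w ∘ Sum.inr) ∘ Sum.inl) →
              (Fin.cons (v 0) y : Fin (k + 1) → M) ∈ X (w ∘ Sum.inl)) <|
          definable_imp
            (definable_ballk (definableMap_comp _) (definableMap_univ_const _)
              (definableMap_univ_const _))
            (hX.mem (definableMap_univ_const _)
              (definableMap_cons (DefinableFun.proj L) (definableMap_comp _))))
      exact this) hw
    have hd : (w ∘ Sum.inr) ∘ Sum.inr ∈ S.dom := (hx (ent_refl hc x)).1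
    obtain ⟨e, he, hec, hed⟩ := exists_ent_subset₂ hc hd
    refine ⟨w ∘ Sum.inl, Fin.cons x ((w ∘ Sum.inr) ∘ Sum.inl), e, he, fun z hz => ?_⟩
    have := (hx (hec (hz 0))).2 (Fin.tail z) fun i => hed (hz i.succ)
    rwa [Fin.cons_self_tail] at this

theorem hasInt_of_hasGrid {k : ℕ} {X : Set (Fin k → M)} (hX : DefSet L M X)
    (h : ∀ N, HasGrid N X) : S.toDefUniformBasis.HasInt X := by
  obtain ⟨_, hp⟩ := exists_hasInt_of_hasGrid (S := S) (ι := Fin 0) (X := fun _ => X)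
    (definable_mem hX (definableMap_comp _)) fun N => ⟨Fin.elim0, h N⟩
  exact hp

theorem exists_hasInt_of_iUnion {k : ℕ} {κ : Type} [Finite κ] {X : κ → Set (Fin k → M)}
    (hX : ∀ j, DefSet L M (X j)) (h : S.toDefUniformBasis.HasInt (⋃ j, X j)) :
    ∃ j, S.toDefUniformBasis.HasInt (X j) := by
  obtain ⟨j, hj⟩ := exists_hasGrid_of_iUnion (hasGrid_of_hasInt h)
  exact ⟨j, hasInt_of_hasGrid (hX j) hj⟩

theorem hasInt_or_hasInt_diff {k : ℕ} {X Y : Set (Fin k → M)} (hX : DefSet L M X)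
    (hY : DefSet L M Y) (h : S.toDefUniformBasis.HasInt X) :
    S.toDefUniformBasis.HasInt (X ∩ Y) ∨ S.toDefUniformBasis.HasInt (X \ Y) := by
  obtain ⟨j, hj⟩ := exists_hasInt_of_iUnion (S := S) (κ := Bool)
    (X := fun b => cond b (X ∩ Y) (X \ Y))
    (Bool.rec (hX.sdiff hY) (hX.inter hY))
    (h.mono fun x hx => by
      by_cases hxY : x ∈ Y
      · exact Set.mem_iUnion.2 ⟨true, hx, hxY⟩
      · exact Set.mem_iUnion.2 ⟨false, hx, hxY⟩)
  cases j
  · exact Or.inr hj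
  · exact Or.inl hj

/-- If an increasing definable union, indexed by the entourages, has nonempty interior, then so
does one of its members. -/
theorem exists_hasInt_of_directed {k : ℕ} {X : (Fin S.n → M) → Set (Fin k → M)}
    (hX : DefFam Set.univ L X)
    (hmono : ∀ c d, S.toDefUniformBasis.ent d ⊆ S.toDefUniformBasis.ent c → X c ⊆ X d)
    {V : Set (Fin k → M)} (hV : S.toDefUniformBasis.HasInt V)
    (hVX : ∀ x ∈ V, ∃ c ∈ S.dom, x ∈ X c) :
    ∃ c ∈ S.dom, S.toDefUniformBasis.HasInt (X c) := by
  obtain ⟨c, x, d, hd, hx⟩ := exists_hasInt_of_hasGrid (S := S)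
    (X := fun c => {x | c ∈ S.dom ∧ x ∈ X c})
    (definable_and (definable_dom (definableMap_comp _))
      (hX.mem (definableMap_comp _) (definableMap_comp _))) (fun N => by
      obtain ⟨B, hB, hBV⟩ := hasGrid_of_hasInt hV N
      have := S.nonempty
      choose! c hc hxc using hVX
      obtain ⟨e, he, h⟩ := exists_ent_subset_finset (U := S.toDefUniformBasis)
        (Fintype.piFinset B) (c := c) fun x hx => hc x (hBV x (Fintype.mem_piFinset.1 hx))
      exact ⟨e, B, hB, fun x hx => ⟨he,
        hmono _ _ (h x (Fintype.mem_piFinset.2 hx)) (hxc x (hBV x hx))⟩⟩)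
  exact ⟨c, (hx (mem_ballk_self hd x)).1, x, d, hd, fun y hy => (hx hy).2⟩

section Cut

/-- The points of `X` around which `X` contains a neighbourhood in the direction of the
coordinate `i`. -/
def cut (U : DefUniformBasis L M) {k : ℕ} (i : Fin k) (X : Set (Fin k → M)) : Set (Fin k → M) :=
  {x | x ∈ X ∧ ∃ c, c ∈ U.dom ∧ ∀ b, b ∈ U.ball c (x i) → Function.update x i b ∈ X}

theorem definable_cut {U : DefUniformBasis L M} {k : ℕ} {i : Fin k} {X : Set (Fin k → M)}
    (hX : DefSet L M X) : DefSet L M (cut U i X) :=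
  definable_and hX <| definable_exists <| definable_and (definable_dom (definableMap_comp _)) <|
    definable_forall₁
      (P := fun u b => b ∈ U.ball (u ∘ Sum.inr) ((u ∘ Sum.inl) i) →
        Function.update (u ∘ Sum.inl) i b ∈ X) <|
      definable_imp
        (definable_ball (DefinableFun.proj L) (DefinableFun.proj L) (definableMap_comp _))
        (definable_mem hX (definableMap_update i (DefinableFun.proj L) (definableMap_comp _)))

theorem finite_update_diff_cut {k : ℕ} {X : Set (Fin k → M)} (hX : DefSet L M X) (i : Fin k)
    (x : Fin k → M) :
    {b | Function.update x i b ∈ X \ cut S.toDefUniformBasis i X}.Finite := by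
  by_contra hinf
  have hdef : DefSet L M (X \ cut S.toDefUniformBasis i X) := hX.sdiff (definable_cut hX)
  obtain ⟨b, c, hc, hb⟩ := exists_ball_subset_of_infinite (S := S)
    (D := {b | Function.update x i b ∈ X \ cut S.toDefUniformBasis i X})
    (definable_mem hdef (g := fun v : Fin 1 → M => Function.update x i (v 0))
      (definableMap_update i (DefinableFun.proj L) (definableMap_univ_const x))) hinf
  refine (hb (ent_refl hc b)).2 ⟨(hb (ent_refl hc b)).1, c, hc, fun b' hb' => ?_⟩
  rw [Function.update_self] at hb'
  rw [Function.update_idem]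
  exact (hb hb').1

theorem cons_mem_foldl_cut {U : DefUniformBasis L M} {k : ℕ} (l : List (Fin k))
    {X : Set (Fin (k + 1) → M)} {b : M} {z : Fin k → M}
    (h : (Fin.cons b z : Fin (k + 1) → M) ∈
      (l.map Fin.succ).foldl (fun X i => cut U i X) X) :
    z ∈ l.foldl (fun X i => cut U i X) {z | (Fin.cons b z : Fin (k + 1) → M) ∈ X} := by
  induction l generalizing X with
  | nil => exact h
  | cons i l ih =>
    have := ih h
    simpa only [List.foldl_cons, cut, Set.mem_ofPred_eq, Fin.cons_succ, ← Fin.cons_update]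
      using! this

theorem hasInt_of_foldl_cut_nonempty {k : ℕ} {X : Set (Fin k → M)} (hX : DefSet L M X)
    (h : ((List.finRange k).foldl (fun X i => cut S.toDefUniformBasis i X) X).Nonempty) :
    S.toDefUniformBasis.HasInt X := by
  induction k with
  | zero =>
    obtain ⟨x, hx⟩ := h
    obtain ⟨c, hc⟩ := S.dom_nonempty
    exact ⟨x, c, hc, fun y _ => Subsingleton.elim x y ▸ hx⟩
  | succ k ih =>
    obtain ⟨x, hx⟩ := h
    rw [← Fin.cons_self_tail x, List.finRange_succ, List.foldl_cons] at hx
    have hcut := ih (definable_mem (definable_cut hX)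
      (definableMap_cons (definableFun_univ_const (x 0)) (definableMap_comp id)))
      ⟨_, cons_mem_foldl_cut _ hx⟩
    refine hasInt_of_hasGrid hX fun N => ?_
    obtain ⟨B, hB, hBX⟩ := hasGrid_of_hasInt hcut N
    have key : ∀ z ∈ Fintype.piFinset B, ∃ c, c ∈ S.dom ∧
        ∀ b ∈ S.toDefUniformBasis.ball c (x 0), (Fin.cons b z : Fin (k + 1) → M) ∈ X := by
      intro z hz
      obtain ⟨-, c, hc, h⟩ := hBX z (Fintype.mem_piFinset.1 hz)
      exact ⟨c, hc, by simpa using! h⟩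
    have := S.nonempty
    choose! c hc hcX using key
    obtain ⟨e, he, hec⟩ := exists_ent_subset_finset (U := S.toDefUniformBasis) _ hc
    obtain ⟨B₀, hB₀, hcard⟩ := (ball_infinite he (x 0)).exists_subset_card_eq N
    refine ⟨Fin.cons B₀ B, Fin.cases hcard.ge hB, fun y hy => ?_⟩
    rw [← Fin.cons_self_tail y]
    have hy' : Fin.tail y ∈ Fintype.piFinset B := Fintype.mem_piFinset.2 fun i => hy i.succ
    exact hcX _ hy' _ (hec _ hy' (hB₀ (hy 0)))

/-- An induction principle for definable sets with empty interior. -/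
theorem induction_of_not_hasInt {k : ℕ} {P : Set (Fin k → M) → Prop} (hempty : P ∅)
    (hunion : ∀ X Y, P X → P Y → P (X ∪ Y))
    (hfin : ∀ X (i : Fin k), DefSet L M X → (∀ x, {b | Function.update x i b ∈ X}.Finite) → P X)
    {X : Set (Fin k → M)} (hX : DefSet L M X) (h : ¬ S.toDefUniformBasis.HasInt X) : P X := by
  have key : ∀ (l : List (Fin k)) (X : Set (Fin k → M)), DefSet L M X →
      l.foldl (fun X i => cut S.toDefUniformBasis i X) X = ∅ → P X := by
    intro l
    induction l with
    | nil =>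
      rintro X - rfl
      exact hempty
    | cons i l ih =>
      intro X hX hl
      have hsub : cut S.toDefUniformBasis i X ⊆ X := fun x hx => hx.1
      rw [← Set.union_sdiff_cancel hsub]
      exact hunion _ _ (ih _ (definable_cut hX) hl)
        (hfin _ i (hX.sdiff (definable_cut hX)) (finite_update_diff_cut hX i))
  exact key _ X hX (Set.not_nonempty_iff_eq_empty.1 fun hne =>
    h (hasInt_of_foldl_cut_nonempty hX hne))

end Cut

section Correspondence

theorem exists_infinite_near {V : Set M} (hV : V.Infinite) {F : M → Set M}
    (hFdef : DefSet1 L M {y | ∃ t, t ∈ V ∧ y ∈ F t}) (hfin : ∀ t ∈ V, (F t).Finite)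
    (hne : ∀ t ∈ V, (F t).Nonempty) {c : Fin S.n → M} (hc : c ∈ S.dom) :
    ∃ z, {t | t ∈ V ∧ ∃ y, y ∈ F t ∧ y ∈ S.toDefUniformBasis.ball c z}.Infinite := by
  by_contra! hcon
  by_cases hI : {y | ∃ t, t ∈ V ∧ y ∈ F t}.Finite
  · refine hV ((hI.biUnion fun z _ => hcon z).subset fun t ht => ?_)
    obtain ⟨y, hy⟩ := hne t ht
    exact Set.mem_biUnion (x := y) ⟨t, ht, hy⟩ ⟨ht, y, hy, ent_refl hc y⟩
  · obtain ⟨z, e, he, hz⟩ := exists_ball_subset_of_infinite (S := S) hFdef hI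
    obtain ⟨e', he', hec, hee⟩ := exists_ent_subset₂ hc he
    refine ball_infinite he' z (((hcon z).biUnion fun t ht => hfin t ht.1).subset fun y hy => ?_)
    obtain ⟨t, ht, hyt⟩ := hz (hee hy)
    exact Set.mem_biUnion (x := t) ⟨ht, y, hyt, hec hy⟩ hyt

/-- A definable family of finite nonempty subsets of `M` meets a single ball of a given radius
on a set of parameters with nonempty interior. -/
theorem exists_hasInt_near {d : ℕ} {V : Set (Fin d → M)} (hV : DefSet L M V)
    (hVint : S.toDefUniformBasis.HasInt V) {F : (Fin d → M) → Set M}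
    (hF : DefFam₁ Set.univ L F) (hfin : ∀ u ∈ V, (F u).Finite)
    (hne : ∀ u ∈ V, (F u).Nonempty) {c : Fin S.n → M} (hc : c ∈ S.dom) :
    ∃ z, S.toDefUniformBasis.HasInt
      {u | u ∈ V ∧ ∃ y, y ∈ F u ∧ y ∈ S.toDefUniformBasis.ball c z} := by
  induction d generalizing c with
  | zero =>
    obtain ⟨u, hu⟩ := hVint
    have huV := interiork_subset V hu
    obtain ⟨y, hy⟩ := hne u huV
    exact ⟨y, u, c, hc, fun u' _ => Subsingleton.elim u u' ▸ ⟨huV, y, hy, ent_refl hc y⟩⟩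
  | succ d ih =>
    obtain ⟨c₂, hc₂, hc₂c⟩ := exists_ent_comp hc
    obtain ⟨c₁, hc₁, hc₁c₂⟩ := exists_ent_comp hc₂
    let H : (Fin (d + 1) → M) → Set M := fun u => {w | w ∈ F u ∧ ∃ δ, δ ∈ S.dom ∧
      ∀ t, t ∈ S.toDefUniformBasis.ball δ (u 0) → Function.update u 0 t ∈ V ∧
        ∃ y, y ∈ F (Function.update u 0 t) ∧ y ∈ S.toDefUniformBasis.ball c₂ w}
    have hH : DefFam₁ Set.univ L H := by
      refine definable_and (hF.mem (definableMap_comp _) (DefinableFun.proj L)) <|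
        definable_exists <| definable_and (definable_dom (definableMap_comp _)) <|
        definable_forall₁ (P := fun v t =>
          t ∈ S.toDefUniformBasis.ball (v ∘ Sum.inr) (v (Sum.inl (Sum.inl 0))) →
          Function.update ((v ∘ Sum.inl) ∘ Sum.inl) 0 t ∈ V ∧
          ∃ y, y ∈ F (Function.update ((v ∘ Sum.inl) ∘ Sum.inl) 0 t) ∧
            y ∈ S.toDefUniformBasis.ball c₂ (v (Sum.inl (Sum.inr 0)))) <|
        definable_imp
          (definable_ball (DefinableFun.proj L) (DefinableFun.proj L) (definableMap_comp _)) <|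
        definable_and
          (definable_mem hV (definableMap_update 0 (DefinableFun.proj L) (definableMap_comp _))) <|
        definable_exists₁ (P := fun v y =>
          y ∈ F (Function.update (((v ∘ Sum.inl) ∘ Sum.inl) ∘ Sum.inl) 0 (v (Sum.inr 0))) ∧
            y ∈ S.toDefUniformBasis.ball c₂ (v (Sum.inl (Sum.inl (Sum.inr 0))))) <|
        definable_and
          (hF.mem (g := fun v => Function.update ((((v ∘ Sum.inl) ∘ Sum.inl) ∘ Sum.inl) ∘ Sum.inl)
              0 (v (Sum.inl (Sum.inr 0))))
            (definableMap_update 0 (DefinableFun.proj L) (definableMap_comp _))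
            (DefinableFun.proj L))
          (definable_ball (DefinableFun.proj L) (DefinableFun.proj L) (definableMap_univ_const _))
    have hG : DefSet L M {u | ∃ w, w ∈ H u} := definable_exists₁ hH
    have hGint : S.toDefUniformBasis.HasInt {u | ∃ w, w ∈ H u} := by
      refine (hasInt_or_hasInt_diff hV hG hVint).elim
        (fun h => h.mono Set.inter_subset_right) fun ⟨u, r, hr, hu⟩ => ?_
      have hmem : ∀ t ∈ S.toDefUniformBasis.ball r (u 0),
          Function.update u 0 t ∈ V \ {u | ∃ w, w ∈ H u} := fun t ht => hu <| by
        intro i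
        by_cases hi : i = 0
        · subst hi; simpa using! ht
        · simpa [hi] using ent_refl hr (u i)
      have hupd : (Set.univ : Set M).DefinableMap L
          fun v : Fin 1 ⊕ Fin 1 → M => Function.update u 0 (v (Sum.inr 0)) :=
        definableMap_update 0 (DefinableFun.proj L) (definableMap_univ_const u)
      have hball : (Set.univ : Set M).Definable L
          {v : Fin 1 ⊕ Fin 1 → M | v (Sum.inr 0) ∈ S.toDefUniformBasis.ball r (u 0)} :=
        definable_ball (DefinableFun.proj L) (definableFun_univ_const _)
          (definableMap_univ_const _)
      obtain ⟨z, hz⟩ := exists_infinite_near (S := S) (ball_infinite hr (u 0))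
        (F := fun t => F (Function.update u 0 t))
        (definable_exists₁ (P := fun (v : Fin 1 → M) t =>
          t ∈ S.toDefUniformBasis.ball r (u 0) ∧ v 0 ∈ F (Function.update u 0 t)) <|
          definable_and hball (hF.mem hupd (DefinableFun.proj L)))
        (fun t ht => hfin _ (hmem t ht).1) (fun t ht => hne _ (hmem t ht).1) hc₁
      obtain ⟨t, δ, hδ, ht⟩ := exists_ball_subset_of_infinite (S := S)
        (D := {t | t ∈ S.toDefUniformBasis.ball r (u 0) ∧ ∃ y, y ∈ F (Function.update u 0 t) ∧
          y ∈ S.toDefUniformBasis.ball c₁ z})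
        (definable_and
          (definable_ball (DefinableFun.proj L) (definableFun_univ_const _)
            (definableMap_univ_const _))
          (definable_exists₁ (P := fun (v : Fin 1 → M) y => y ∈ F (Function.update u 0 (v 0)) ∧
              y ∈ S.toDefUniformBasis.ball c₁ z) <|
            definable_and
              (hF.mem (g := fun v : Fin 1 ⊕ Fin 1 → M => Function.update u 0 (v (Sum.inl 0)))
                (definableMap_update 0 (DefinableFun.proj L) (definableMap_univ_const u))
                (DefinableFun.proj L))
              (definable_ball (DefinableFun.proj L) (definableFun_univ_const _)
                (definableMap_univ_const _)))) hz
      obtain ⟨htB, w, hw, hwz⟩ := ht (ent_refl hδ t)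
      refine absurd ⟨w, hw, δ, hδ, fun t' ht' => ?_⟩ (hmem t htB).2
      rw [Function.update_self] at ht'
      obtain ⟨htB', y, hy, hyz⟩ := ht ht'
      rw [Function.update_idem]
      exact ⟨(hmem t' htB').1, y, hy, hc₁c₂ _ _ _ (ent_symm hc₁ hwz) hyz⟩
    have hGV : ∀ u, (∃ w, w ∈ H u) → u ∈ V := fun u ⟨w, hw, δ, hδ, h⟩ => by
      simpa using (h (u 0) (ent_refl hδ _)).1
    obtain ⟨u, r, hr, hu⟩ := hGint
    obtain ⟨z, hz⟩ := ih (V := {x | ∃ w, w ∈ H (Fin.cons (u 0) x)})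
      (definable_mem hG (definableMap_cons (definableFun_univ_const (u 0)) (definableMap_comp id)))
      ⟨Fin.tail u, r, hr, fun x hx => hu (Fin.cases (ent_refl hr (u 0)) hx)⟩
      (F := fun x => H (Fin.cons (u 0) x))
      (hH.mem (definableMap_cons (definableFun_univ_const (u 0)) (definableMap_comp _))
        (DefinableFun.proj L))
      (fun x hx => (hfin _ (hGV _ hx)).subset fun w hw => hw.1) (fun x hx => hx) hc₂
    refine ⟨z, hasInt_of_hasGrid (definable_and hV <| definable_exists₁ <|
      definable_and (hF.mem (definableMap_comp _) (DefinableFun.proj L))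
        (definable_ball (DefinableFun.proj L) (definableFun_univ_const _)
          (definableMap_univ_const _))) fun N => ?_⟩
    obtain ⟨B, hB, hBX⟩ := hasGrid_of_hasInt hz N
    have key : ∀ x ∈ Fintype.piFinset B, ∃ δ, δ ∈ S.dom ∧
        ∀ t ∈ S.toDefUniformBasis.ball δ (u 0), (Fin.cons t x : Fin (d + 1) → M) ∈ V ∧
          ∃ y, y ∈ F (Fin.cons t x) ∧ y ∈ S.toDefUniformBasis.ball c z := by
      intro x hx
      obtain ⟨-, w, ⟨-, δ, hδ, h⟩, hwz⟩ := hBX x (Fintype.mem_piFinset.1 hx)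
      refine ⟨δ, hδ, fun t ht => ?_⟩
      obtain ⟨h₁, y, hy, hyw⟩ := h t ht
      rw [Fin.update_cons_zero] at h₁ hy
      exact ⟨h₁, y, hy, hc₂c _ _ _ hwz hyw⟩
    have := S.nonempty
    choose! δ hδ hδX using key
    obtain ⟨e, he, hec⟩ := exists_ent_subset_finset (U := S.toDefUniformBasis) _ hδ
    obtain ⟨B₀, hB₀, hcard⟩ := (ball_infinite he (u 0)).exists_subset_card_eq N
    refine ⟨Fin.cons B₀ B, Fin.cases hcard.ge hB, fun y hy => ?_⟩
    rw [← Fin.cons_self_tail y]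
    have hy' : Fin.tail y ∈ Fintype.piFinset B := Fintype.mem_piFinset.2 fun i => hy i.succ
    exact hδX _ hy' _ (hec _ hy' (hB₀ (hy 0)))

theorem exists_ncard_le {ι : Type} [Finite ι] {F : (ι → M) → Set M} (S : Setting L M)
    (hF : DefFam₁ Set.univ L F) (hfin : ∀ u, (F u).Finite) : ∃ m, ∀ u, (F u).ncard ≤ m := by
  by_contra! h
  obtain ⟨p, hp⟩ := exists_infinite_of_unbounded S.saturated hF fun n => by
    obtain ⟨u, hu⟩ := h n
    rw [Set.ncard_eq_toFinset_card _ (hfin u)] at hu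
    obtain ⟨t, ht, hcard⟩ := Finset.exists_subset_card_eq hu.le
    refine ⟨u, fun i => ((t.equivFinOfCardEq hcard).symm i : M),
      Subtype.val_injective.comp (Equiv.injective _), fun i => ?_⟩
    exact (hfin u).mem_toFinset.1 (ht (Subtype.property _))
  exact hp (hfin p)

theorem exists_hasInt_subset_iUnion_ball {d : ℕ} {V : Set (Fin d → M)} (hV : DefSet L M V)
    (hVint : S.toDefUniformBasis.HasInt V) {F : (Fin d → M) → Set M}
    (hF : DefFam₁ Set.univ L F) {m : ℕ} (hfin : ∀ u ∈ V, (F u).Finite)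
    (hm : ∀ u ∈ V, (F u).ncard ≤ m) {c : Fin S.n → M} (hc : c ∈ S.dom) :
    ∃ W ⊆ V, DefSet L M W ∧ S.toDefUniformBasis.HasInt W ∧ ∃ Z : Set M, Z.Finite ∧
      ∀ u ∈ W, ∀ y ∈ F u, ∃ z ∈ Z, y ∈ S.toDefUniformBasis.ball c z := by
  induction m generalizing V F with
  | zero =>
    refine ⟨V, subset_rfl, hV, hVint, ∅, Set.finite_empty, fun u hu y hy => ?_⟩
    have := (Set.ncard_eq_zero (hfin u hu)).1 (Nat.le_zero.1 (hm u hu))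
    simp [this] at hy
  | succ m ih =>
    have hN : DefSet L M {u | ∃ y, y ∈ F u} := definable_exists₁ hF
    rcases hasInt_or_hasInt_diff hV hN hVint with h | h
    · obtain ⟨z, hz⟩ := exists_hasInt_near (hV.inter hN) h hF (fun u hu => hfin u hu.1)
        (fun u hu => hu.2) hc
      obtain ⟨W, hWV, hW, hWint, Z, hZ, hcov⟩ := ih
        (V := {u | u ∈ V ∩ {u | ∃ y, y ∈ F u} ∧ ∃ y, y ∈ F u ∧ y ∈ S.toDefUniformBasis.ball c z})
        (F := fun u => {y | y ∈ F u ∧ ¬ y ∈ S.toDefUniformBasis.ball c z})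
        (definable_and (hV.inter hN) <| definable_exists₁ <| definable_and hF <|
          definable_ball (DefinableFun.proj L) (definableFun_univ_const _)
            (definableMap_univ_const _)) hz
        (definable_and hF <| definable_not <|
          definable_ball (DefinableFun.proj L) (definableFun_univ_const _)
            (definableMap_univ_const _))
        (fun u hu => (hfin u hu.1.1).subset fun y hy => hy.1)
        (fun u ⟨⟨hu, _⟩, y, hy, hyz⟩ => Nat.le_of_lt_succ <| lt_of_lt_of_le
          (Set.ncard_lt_ncard ⟨fun y hy => hy.1, fun hsub => (hsub hy).2 hyz⟩ (hfin u hu))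
          (hm u hu))
      refine ⟨W, fun u hu => (hWV hu).1.1, hW, hWint, insert z Z, hZ.insert z,
        fun u hu y hy => ?_⟩
      by_cases hyz : y ∈ S.toDefUniformBasis.ball c z
      · exact ⟨z, Set.mem_insert _ _, hyz⟩
      · obtain ⟨z', hz', h'⟩ := hcov u hu y ⟨hy, hyz⟩
        exact ⟨z', Set.mem_insert_of_mem _ hz', h'⟩
    · exact ⟨_, Set.sdiff_subset, hV.sdiff hN, h, ∅, Set.finite_empty,
        fun u hu y hy => absurd ⟨y, hy⟩ hu.2⟩

theorem exists_hasInt_subset_iUnion_ball_of_family {d : ℕ} {β : Type*} [Finite β]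
    {V : Set (Fin d → M)} (hV : DefSet L M V) (hVint : S.toDefUniformBasis.HasInt V)
    {F : β → (Fin d → M) → Set M} (hF : ∀ j, DefFam₁ Set.univ L (F j))
    (hfin : ∀ j u, (F j u).Finite) {c : Fin S.n → M} (hc : c ∈ S.dom) :
    ∃ W ⊆ V, DefSet L M W ∧ S.toDefUniformBasis.HasInt W ∧ ∃ Z : Set M, Z.Finite ∧
      ∀ j, ∀ u ∈ W, ∀ y ∈ F j u, ∃ z ∈ Z, y ∈ S.toDefUniformBasis.ball c z := by
  classical
  have := Fintype.ofFinite β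
  suffices h : ∀ s : Finset β, ∃ W ⊆ V, DefSet L M W ∧ S.toDefUniformBasis.HasInt W ∧
      ∃ Z : Set M, Z.Finite ∧ ∀ j ∈ s, ∀ u ∈ W, ∀ y ∈ F j u,
        ∃ z ∈ Z, y ∈ S.toDefUniformBasis.ball c z by
    simpa using h Finset.univ
  intro s
  induction s using Finset.induction_on with
  | empty => exact ⟨V, subset_rfl, hV, hVint, ∅, Set.finite_empty, by simp⟩
  | insert j s _ ih =>
    obtain ⟨W, hWV, hW, hWint, Z, hZ, h⟩ := ih
    obtain ⟨m, hm⟩ := exists_ncard_le S (hF j) (hfin j)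
    obtain ⟨W', hWW', hW', hWint', Z', hZ', h'⟩ := exists_hasInt_subset_iUnion_ball hW hWint
      (hF j) (fun u _ => hfin j u) (fun u _ => hm u) hc
    refine ⟨W', hWW'.trans hWV, hW', hWint', Z ∪ Z', hZ.union hZ', fun i hi u hu y hy => ?_⟩
    rcases Finset.mem_insert.1 hi with rfl | hi
    · obtain ⟨z, hz, hyz⟩ := h' u hu y hy
      exact ⟨z, Or.inr hz, hyz⟩
    · obtain ⟨z, hz, hyz⟩ := h i hi u (hWW' hu) y hy
      exact ⟨z, Or.inl hz, hyz⟩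

theorem exists_hasInt_subset_or_disjoint {d : ℕ} {β : Type*} [Finite β] {V : Set (Fin d → M)}
    (hV : DefSet L M V) (hVint : S.toDefUniformBasis.HasInt V) {T : β → Set (Fin d → M)}
    (hT : ∀ b, DefSet L M (T b)) :
    ∃ W ⊆ V, S.toDefUniformBasis.HasInt W ∧ ∀ b, W ⊆ T b ∨ Disjoint W (T b) := by
  classical
  have := Fintype.ofFinite β
  suffices h : ∀ s : Finset β, ∃ W ⊆ V, DefSet L M W ∧ S.toDefUniformBasis.HasInt W ∧
      ∀ b ∈ s, W ⊆ T b ∨ Disjoint W (T b) by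
    obtain ⟨W, hWV, -, hW, h⟩ := h Finset.univ
    exact ⟨W, hWV, hW, fun b => h b (Finset.mem_univ b)⟩
  intro s
  induction s using Finset.induction_on with
  | empty => exact ⟨V, subset_rfl, hV, hVint, by simp⟩
  | insert b s _ ih =>
    obtain ⟨W, hWV, hW, hWint, h⟩ := ih
    rcases hasInt_or_hasInt_diff hW (hT b) hWint with h' | h'
    · refine ⟨_, Set.inter_subset_left.trans hWV, hW.inter (hT b), h', fun i hi => ?_⟩
      rcases Finset.mem_insert.1 hi with rfl | hi
      · exact Or.inl Set.inter_subset_right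
      · exact (h i hi).imp Set.inter_subset_left.trans fun h => h.mono_left Set.inter_subset_left
    · refine ⟨_, Set.sdiff_subset.trans hWV, hW.sdiff (hT b), h', fun i hi => ?_⟩
      rcases Finset.mem_insert.1 hi with rfl | hi
      · exact Or.inr Set.disjoint_sdiff_left
      · exact (h i hi).imp Set.sdiff_subset.trans fun h => h.mono_left Set.sdiff_subset

theorem definable_map_eq {C : Set M} {α κ : Type} [Finite κ] {g h : (α → M) → κ → M}
    (hg : C.DefinableMap L g) (hh : C.DefinableMap L h) : C.Definable L {v | g v = h v} := by
  simpa only [funext_iff] using definable_forall_finite fun i => definable_eq (hg i) (hh i)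

theorem definable_comp_eq {C : Set M} {α : Type} {k d : ℕ} (σ : Fin d → Fin k)
    {y : (α → M) → Fin k → M} {u : (α → M) → Fin d → M} (hy : C.DefinableMap L y)
    (hu : C.DefinableMap L u) : C.Definable L {v | y v ∘ σ = u v} :=
  definable_map_eq (g := fun v => y v ∘ σ) (fun i => hy (σ i)) hu

theorem exists_forall_notMem_ballk {k : ℕ} {X : Set (Fin k → M)} (hX : X.Finite)
    {y : Fin k → M} (hy : y ∉ X) : ∃ c ∈ S.dom, ∀ x ∈ X, x ∉ S.toDefUniformBasis.ballk c y := by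
  have key : ∀ x ∈ X, ∃ c, c ∈ S.dom ∧ x ∉ S.toDefUniformBasis.ballk c y := fun x hx => by
    by_contra! h
    refine hy ((funext fun i => ?_ : y = x) ▸ hx)
    exact (S.inter_eq_diag _ _).1 fun c hc => h c hc i
  have := S.nonempty
  choose! c hc hcx using key
  obtain ⟨e, he, hec⟩ := exists_ent_subset_finset (U := S.toDefUniformBasis) hX.toFinset
    (c := c) fun x hx => hc x (hX.mem_toFinset.1 hx)
  exact ⟨e, he, fun x hx hxe =>
    hcx x hx (ballk_mono (hec x (hX.mem_toFinset.2 hx)) y hxe)⟩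

/-- If the projection of a definable set `A` along `σ` has finite fibres, then generically the
fibres of `A` are closed under adding limit points of `A`. -/
theorem not_hasInt_image_frontierk {k d : ℕ} {A : Set (Fin k → M)} (hA : DefSet L M A)
    (σ : Fin d → Fin k) (hfin : ∀ u, {x | x ∈ A ∧ x ∘ σ = u}.Finite) :
    ¬ S.toDefUniformBasis.HasInt
      {u | ∃ y, y ∈ S.toDefUniformBasis.frontierk A ∧ y ∘ σ = u} := by
  intro hV
  obtain ⟨c, hc, hE⟩ := exists_hasInt_of_directed (S := S)
    (X := fun c => {u | ∃ y, y ∈ S.toDefUniformBasis.closurek A ∧ y ∘ σ = u ∧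
      ∀ x, x ∈ A → x ∘ σ = u → ¬ x ∈ S.toDefUniformBasis.ballk c y})
    (definable_exists <| definable_and (definable_mem (definable_closurek hA)
        (definableMap_comp _)) <|
      definable_and (definable_comp_eq σ (definableMap_comp _) (definableMap_comp _)) <|
      definable_forall (P := fun v x => x ∈ A → x ∘ σ = (v ∘ Sum.inl) ∘ Sum.inr →
        ¬ x ∈ S.toDefUniformBasis.ballk ((v ∘ Sum.inl) ∘ Sum.inl) (v ∘ Sum.inr)) <|
      definable_imp (definable_mem hA (definableMap_comp _)) <|
      definable_imp (definable_comp_eq σ (definableMap_comp _) (definableMap_comp _)) <|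
      definable_not <| definable_ballk (definableMap_comp _) (definableMap_comp _)
        (definableMap_comp _))
    (fun c d hcd u ⟨y, hy, hyu, h⟩ => ⟨y, hy, hyu, fun x hx hxu hxd =>
      h x hx hxu (ballk_mono hcd y hxd)⟩) hV
    (fun u ⟨y, hy, hyu⟩ => by
      obtain ⟨c, hc, h⟩ := exists_forall_notMem_ballk (S := S) (hfin u) fun h => hy.2 h.1
      exact ⟨c, hc, y, hy.1, hyu, fun x hx hxu => h x ⟨hx, hxu⟩⟩)
  obtain ⟨c₁, hc₁, hc₁c⟩ := exists_ent_comp hc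
  obtain ⟨c₂, hc₂, hc₂c₁⟩ := exists_ent_comp hc₁
  obtain ⟨W, hWE, hW, hWint, Z, hZ, hcov⟩ := exists_hasInt_subset_iUnion_ball_of_family
    (definable_exists <| definable_and (definable_mem (definable_closurek hA)
        (definableMap_comp _)) <|
      definable_and (definable_comp_eq σ (definableMap_comp _) (definableMap_comp _)) <|
      definable_forall (P := fun v x => x ∈ A → x ∘ σ = v ∘ Sum.inl →
        ¬ x ∈ S.toDefUniformBasis.ballk c (v ∘ Sum.inr)) <|
      definable_imp (definable_mem hA (definableMap_comp _)) <|
      definable_imp (definable_comp_eq σ (definableMap_comp _) (definableMap_comp _)) <|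
      definable_not <| definable_ballk (definableMap_comp _) (definableMap_comp _)
        (definableMap_univ_const _)) hE
    (F := fun j u => {b | ∃ x, (x ∈ A ∧ x ∘ σ = u) ∧ x j = b})
    (fun j => definable_exists <| definable_and
      (definable_and (definable_mem hA (definableMap_comp _))
        (definable_comp_eq σ (definableMap_comp _) (definableMap_comp _)))
      (definable_eq (DefinableFun.proj L) (DefinableFun.proj L)))
    (fun j u => (hfin u).image fun x : Fin k → M => x j) hc₂
  have := hZ.to_subtype
  obtain ⟨W', hWW', ⟨u, r, hr, hu⟩, hT⟩ := exists_hasInt_subset_or_disjoint hW hWint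
    (T := fun z : Fin k → Z => {u | ∃ x, (x ∈ A ∧ x ∘ σ = u) ∧
      x ∈ S.toDefUniformBasis.ballk c₂ fun i => (z i : M)})
    (fun z => definable_exists <| definable_and
      (definable_and (definable_mem hA (definableMap_comp _))
        (definable_comp_eq σ (definableMap_comp _) (definableMap_comp _)))
      (definable_ballk (definableMap_comp _) (definableMap_univ_const _)
        (definableMap_univ_const _)))
  have huW' := hu (mem_ballk_self hr u)
  obtain ⟨y, hy, rfl, hyA⟩ := hWE (hWW' huW')
  obtain ⟨e, he, her, hec₂⟩ := exists_ent_subset₂ hr hc₂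
  obtain ⟨x', hx'y, hx'⟩ := hy e he
  have hx'W' : x' ∘ σ ∈ W' := hu fun i => her (hx'y (σ i))
  choose z hz hxz using fun j => hcov j _ (hWW' hx'W') _ ⟨x', ⟨hx', rfl⟩, rfl⟩
  have hx'T : x' ∘ σ ∈ {u | ∃ x, (x ∈ A ∧ x ∘ σ = u) ∧
      x ∈ S.toDefUniformBasis.ballk c₂ z} := ⟨x', ⟨hx', rfl⟩, hxz⟩
  rcases hT fun j => ⟨z j, hz j⟩ with h | h
  · obtain ⟨x, ⟨hx, hxy⟩, hxz'⟩ := h huW'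
    exact hyA x hx hxy fun i => hc₁c _ _ _
      (hc₂c₁ _ _ _ (hec₂ (hx'y i)) (ent_symm hc₂ (hxz i)))
      (ent_subset_of_comp hc₂ hc₂c₁ (hxz' i))
  · exact Set.disjoint_left.1 h hx'W' hx'T

end Correspondence

section Constructible

/-- `A ⊆ M^k` is a finite union of differences of definable open sets. -/
def IsConstructiblek (U : DefUniformBasis L M) {k : ℕ} (A : Set (Fin k → M)) : Prop :=
  ∃ (n : ℕ) (V W : Fin n → Set (Fin k → M)),
    (∀ i, DefSet L M (V i) ∧ DefSet L M (W i) ∧ U.IsOpenk (V i) ∧ U.IsOpenk (W i)) ∧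
    A = ⋃ i, (V i \ W i)

theorem isConstructiblek_empty {U : DefUniformBasis L M} {k : ℕ} :
    IsConstructiblek U (∅ : Set (Fin k → M)) :=
  ⟨0, Fin.elim0, Fin.elim0, fun i => i.elim0, by simp⟩

theorem isConstructiblek_sdiff {U : DefUniformBasis L M} {k : ℕ} {V W : Set (Fin k → M)}
    (hV : DefSet L M V) (hW : DefSet L M W) (hVo : U.IsOpenk V) (hWo : U.IsOpenk W) :
    IsConstructiblek U (V \ W) :=
  ⟨1, fun _ => V, fun _ => W, fun _ => ⟨hV, hW, hVo, hWo⟩, (Set.iUnion_const _).symm⟩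

theorem isConstructiblek_union {U : DefUniformBasis L M} {k : ℕ} {A B : Set (Fin k → M)}
    (hA : IsConstructiblek U A) (hB : IsConstructiblek U B) : IsConstructiblek U (A ∪ B) := by
  obtain ⟨n, V, W, h, rfl⟩ := hA
  obtain ⟨n', V', W', h', rfl⟩ := hB
  refine ⟨n + n', Fin.append V V', Fin.append W W', fun i => ?_, ?_⟩
  · refine Fin.addCases (fun i => ?_) (fun i => ?_) i
    · simpa only [Fin.append_left] using h i
    · simpa only [Fin.append_right] using h' i
  · rw [← finSumFinEquiv.surjective.iUnion_comp, Set.iUnion_sum]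
    simp

theorem not_hasInt_closurek {k : ℕ} {X : Set (Fin k → M)} (hX : DefSet L M X)
    (h : ¬ S.toDefUniformBasis.HasInt X) :
    ¬ S.toDefUniformBasis.HasInt (S.toDefUniformBasis.closurek X) := by
  intro hcl
  rcases hasInt_or_hasInt_diff (definable_closurek hX) hX hcl with h' | ⟨x, c, hc, hx⟩
  · exact h (h'.mono Set.inter_subset_right)
  · obtain ⟨y, hy, hyX⟩ := (hx (mem_ballk_self hc x)).1 c hc
    exact (hx hy).2 hyX

theorem isConstructiblek_of_forall {k d : ℕ} {A : Set (Fin k → M)} (hA : DefSet L M A)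
    (σ : Fin d → Fin k) (hfin : ∀ u, {x | x ∈ A ∧ x ∘ σ = u}.Finite)
    (h : ∀ X (i : Fin d), DefSet L M X → (∀ u, {b | Function.update u i b ∈ X}.Finite) →
      IsConstructiblek S.toDefUniformBasis (A ∩ {x | x ∘ σ ∈ X})) :
    IsConstructiblek S.toDefUniformBasis A := by
  set D := {u | ∃ y, y ∈ S.toDefUniformBasis.frontierk A ∧ y ∘ σ = u}
  have hD : DefSet L M D := definable_exists <| definable_and
    (definable_mem ((definable_closurek hA).sdiff hA) (definableMap_comp _))
    (definable_comp_eq σ (definableMap_comp _) (definableMap_comp _))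
  have hDint : ¬ S.toDefUniformBasis.HasInt D := not_hasInt_image_frontierk hA σ hfin
  have hsmall : IsConstructiblek S.toDefUniformBasis
      (A ∩ {x | x ∘ σ ∈ S.toDefUniformBasis.closurek D}) :=
    induction_of_not_hasInt (S := S)
      (P := fun X => IsConstructiblek S.toDefUniformBasis (A ∩ {x | x ∘ σ ∈ X}))
      (by simpa using! isConstructiblek_empty)
      (fun X Y hX hY => by
        have := isConstructiblek_union hX hY
        rwa [← Set.inter_union_distrib_left] at this) h
      (definable_closurek hD) (not_hasInt_closurek hD hDint)
  have hlarge : IsConstructiblek S.toDefUniformBasis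
      ({x | x ∘ σ ∈ S.toDefUniformBasis.interiork Dᶜ} \ S.toDefUniformBasis.interiork Aᶜ) :=
    isConstructiblek_sdiff
      (definable_mem (definable_interiork (Set.Definable.compl hD))
        (fun i => DefinableFun.proj L))
      (definable_interiork (Set.Definable.compl hA))
      (isOpenk_preimage_comp σ (isOpenk_interiork _)) (isOpenk_interiork _)
  convert isConstructiblek_union hlarge hsmall using 1
  rw [← compl_closurek, ← compl_closurek]
  have hsub : ∀ {j : ℕ} (X : Set (Fin j → M)), X ⊆ S.toDefUniformBasis.closurek X :=
    fun X x hx c hc => ⟨x, mem_ballk_self hc x, hx⟩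
  ext x
  by_cases hx : x ∘ σ ∈ S.toDefUniformBasis.closurek D
  · simp [hx]
  · have : x ∈ S.toDefUniformBasis.closurek A ↔ x ∈ A :=
      ⟨fun h => by_contra fun hxA => hx (hsub D ⟨x, ⟨h, hxA⟩, rfl⟩), fun h => hsub A h⟩
    simp [hx, this]

theorem isConstructiblek_of_finite_fibres {k d : ℕ} {A : Set (Fin k → M)} (hA : DefSet L M A)
    (σ : Fin d → Fin k) (hfin : ∀ u, {x | x ∈ A ∧ x ∘ σ = u}.Finite) :
    IsConstructiblek S.toDefUniformBasis A := by
  induction d generalizing A with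
  | zero => exact isConstructiblek_of_forall hA σ hfin fun _ i => i.elim0
  | succ d ih =>
    refine isConstructiblek_of_forall hA σ hfin fun X i hX hXfin => ?_
    refine ih (hA.inter (definable_mem hX fun i => DefinableFun.proj L)) (σ ∘ i.succAbove)
      fun u => ?_
    obtain ⟨m⟩ := S.nonempty
    refine ((hXfin (i.insertNth m u)).biUnion fun b _ =>
      hfin (Function.update (i.insertNth m u) i b)).subset fun x ⟨⟨hxA, hxX⟩, hxu⟩ => ?_
    have hx : x ∘ σ = Function.update (i.insertNth m u) i (x (σ i)) := by
      funext j
      refine Fin.succAboveCases i ?_ (fun j => ?_) j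
      · simp
      · simp [← hxu]
    refine Set.mem_biUnion (x := x (σ i)) ?_ ⟨hxA, hx⟩
    rwa [Set.mem_ofPred_eq, ← hx]

theorem isConstructiblek_of_definable (S : Setting L M) {k : ℕ} {A : Set (Fin k → M)}
    (hA : DefSet L M A) : IsConstructiblek S.toDefUniformBasis A :=
  isConstructiblek_of_finite_fibres hA id fun u =>
    (Set.finite_singleton u).subset fun _ hx => hx.2

end Constructible

end Setting

/-- Every definable subset of `M^k` is a finite union of definable locally closed
sets; consequently it is a boolean combination of definable open sets (a finite union of
differences of definable open sets). -/
theorem statement5 (S : Setting L M) {k : ℕ} (A : Set (Fin k → M)) (hA : DefSet L M A) :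
    (∃ (n : ℕ) (B : Fin n → Set (Fin k → M)),
      (∀ i, DefSet L M (B i) ∧ S.toDefUniformBasis.IsLocallyClosedk (B i)) ∧
      A = ⋃ i, B i) ∧
    (∃ (n : ℕ) (V W : Fin n → Set (Fin k → M)),
      (∀ i, DefSet L M (V i) ∧ DefSet L M (W i) ∧
        S.toDefUniformBasis.IsOpenk (V i) ∧ S.toDefUniformBasis.IsOpenk (W i)) ∧
      A = ⋃ i, (V i \ W i)) := by
  obtain ⟨n, V, W, h, hVW⟩ := Setting.isConstructiblek_of_definable S hA
  exact ⟨⟨n, fun i => V i \ W i, fun i => ⟨(h i).1.sdiff (h i).2.1,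
    DefUniformBasis.isLocallyClosedk_sdiff (h i).2.2.1 (h i).2.2.2⟩, hVW⟩, n, V, W, h, hVW⟩

end DpTame
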